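/- There does not exist a centrally symmetric, convex, simple closed smooth curve in ℝ^4. That is, there is no smooth injective map γ : S^1 → ℝ^4 whose image Γ satisfies both: (i) every affine hyperplane of ℝ^4 intersects Γ in at most 4 points, and (ii) there is a point c ∈ ℝ^4 with 2c − Γ = Γ. -/

import Mathlib

open scoped Manifold
open RealInnerProductSpace

/-- Fewer vectors than the dimension have a common nonzero orthogonal vector. -/
lemma exists_ne_zero_forall_inner_eq_zero {E : Type*} [NormedAddCommGroup E]
    [InnerProductSpace ℝ E] [FiniteDimensional ℝ E] {m : ℕ} (v : Fin m → E)
    (hm : m < Module.finrank ℝ E) : ∃ a : E, a ≠ 0 ∧ ∀ i, ⟪a, v i⟫ = 0 := by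
  have hlt : Module.finrank ℝ (Submodule.span ℝ (Set.range v)) < Module.finrank ℝ E :=
    (finrank_range_le_card v).trans_lt (by simpa using hm)
  have hne : (Submodule.span ℝ (Set.range v))ᗮ ≠ ⊥ := fun h => by
    rw [Submodule.orthogonal_eq_bot_iff] at h
    rw [h, finrank_top] at hlt
    exact lt_irrefl _ hlt
  obtain ⟨a, ha, ha0⟩ := Submodule.exists_mem_ne_zero_of_ne_bot hne
  exact ⟨a, ha0, fun i =>
    Submodule.inner_left_of_mem_orthogonal (Submodule.subset_span (Set.mem_range_self i)) ha⟩

/-- An infinite set in `ℝ^4` that is mapped into itself by a point reflection meets some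
affine hyperplane in more than `4` points. -/
lemma exists_hyperplane_four_lt_encard {s : Set (EuclideanSpace ℝ (Fin 4))} (hs : s.Infinite)
    {c : EuclideanSpace ℝ (Fin 4)} (hc : ∀ x ∈ s, (2 : ℝ) • c - x ∈ s) :
    ∃ (a : EuclideanSpace ℝ (Fin 4)) (e : ℝ), a ≠ 0 ∧
      4 < (s ∩ {x | ⟪a, x⟫ = e}).encard := by
  classical
  set r : EuclideanSpace ℝ (Fin 4) → EuclideanSpace ℝ (Fin 4) := fun x => (2 : ℝ) • c - x with hr
  have hrr : ∀ x, r (r x) = x := fun x => by simp [hr]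
  have hfix : ∀ x, r x = x → x = c := fun x hx => by
    have h : (2 : ℝ) • c = (2 : ℝ) • x := by
      rw [two_smul ℝ x]
      exact sub_eq_iff_eq_add.mp hx
    exact (smul_right_injective _ (two_ne_zero (α := ℝ)) h).symm
  obtain ⟨p, hp, hp'⟩ := hs.exists_notMem_finset {c}
  obtain ⟨q, hq, hq'⟩ := hs.exists_notMem_finset {c, p, r p}
  obtain ⟨u, hu, hu'⟩ := hs.exists_notMem_finset {c, p, r p, q, r q}
  simp only [Finset.mem_insert, Finset.mem_singleton, not_or] at hp' hq' hu'
  obtain ⟨a, ha, hv⟩ := exists_ne_zero_forall_inner_eq_zero ![p - c, q - c, u - c] (by simp)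
  simp only [Fin.forall_fin_succ, Matrix.cons_val_zero, Matrix.cons_val_succ, inner_sub_right,
    sub_eq_zero] at hv
  obtain ⟨hap, haq, hau, -⟩ := hv
  have har : ∀ x, ⟪a, x⟫ = ⟪a, c⟫ → ⟪a, r x⟫ = ⟪a, c⟫ := fun x hx => by
    simp only [hr, inner_sub_right, inner_smul_right, hx]
    ring
  refine ⟨a, ⟪a, c⟫, ha, ?_⟩
  have hsub : (({p, r p, q, r q, u} : Finset (EuclideanSpace ℝ (Fin 4))) : Set _) ⊆
      s ∩ {x | ⟪a, x⟫ = ⟪a, c⟫} := by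
    intro x hx
    simp only [Finset.coe_insert, Finset.coe_singleton, Set.mem_insert_iff,
      Set.mem_singleton_iff] at hx
    rcases hx with rfl | rfl | rfl | rfl | rfl
    exacts [⟨hp, hap⟩, ⟨hc _ hp, har _ hap⟩, ⟨hq, haq⟩, ⟨hc _ hq, har _ haq⟩, ⟨hu, hau⟩]
  have hcard : ({p, r p, q, r q, u} : Finset (EuclideanSpace ℝ (Fin 4))).card = 5 := by
    clear_value r
    repeat rw [Finset.card_insert_of_notMem (by
      simp only [Finset.mem_insert, Finset.mem_singleton, not_or]
      grind)]
    simp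
  refine lt_of_lt_of_le ?_ (Set.encard_le_encard hsub)
  rw [Set.encard_coe_eq_coe_finsetCard, hcard]
  norm_num

/-- There is no centrally symmetric, convex, simple closed smooth curve in `ℝ^4`:
no smooth injective map `γ : S^1 → ℝ^4` whose image `Γ` meets every affine hyperplane in
at most `4` points and satisfies `2c - Γ = Γ` for some point `c`. -/
theorem no_centrally_symmetric_convex_curve :
    ¬ ∃ γ : Circle → EuclideanSpace ℝ (Fin 4),
      ContMDiff (𝓡 1) 𝓘(ℝ, EuclideanSpace ℝ (Fin 4)) (⊤ : ℕ∞) γ ∧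
      Function.Injective γ ∧
      (∀ (a : EuclideanSpace ℝ (Fin 4)) (e : ℝ), a ≠ 0 →
        (Set.range γ ∩ {x | ⟪a, x⟫ = e}).encard ≤ 4) ∧
      (∃ c : EuclideanSpace ℝ (Fin 4),
        (fun x => (2 : ℝ) • c - x) '' Set.range γ = Set.range γ) := by
  rintro ⟨γ, -, hinj, hconv, c, hc⟩
  have : Infinite Circle := Set.infinite_univ_iff.mp <|
    ((Set.Icc_infinite zero_lt_one).image
      (Circle.exp_injOn_Icc (by linarith [Real.pi_gt_three]))).mono (Set.subset_univ _)
  obtain ⟨a, e, ha, hlt⟩ := exists_hyperplane_four_lt_encard (Set.infinite_range_of_injective hinj)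
    (c := c) fun x hx => hc ▸ Set.mem_image_of_mem _ hx
  exact (hconv a e ha).not_gt hlt
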